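/- Logarithmic uncertainty principle for the STOLCT: for f, φ in the Schwartz class on ℝ³ (real-valued, φ non-zero), 2π|b₃| ∬_{ℝ³×ℝ³} ln|w| |G_φ^{A₁,A₂,A₃}{f}(w,u)|² dw du + ‖φ‖²_{L²} ∫_{ℝ³} ln|x| |f(x)|² dx ≥ D ‖f‖²_{L²} ‖φ‖²_{L²}, where D = ln 2 + Γ'(1/2)/Γ(1/2). -/

import Mathlib

noncomputable section
open MeasureTheory Real

/-- The quaternions over ℝ. -/
abbrev Quat : Type := Quaternion ℝ

/-- Octonions realized as pairs of quaternions (Cayley–Dickson doubling). -/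
abbrev Octo : Type := Quat × Quat

/-- Cayley–Dickson multiplication: (a,b)(c,d) = (ac − d̄b, da + bc̄). -/
def omul (x y : Octo) : Octo :=
  (x.1 * y.1 - star y.2 * x.2, y.2 * x.1 + x.2 * star y.1)

/-- The octonion norm: |(a,b)| = √(‖a‖² + ‖b‖²). -/
def onorm (x : Octo) : ℝ := Real.sqrt (‖x.1‖ ^ 2 + ‖x.2‖ ^ 2)

/-- Octonion imaginary units. -/
def oμ₁ : Octo := ((⟨0,1,0,0⟩ : Quat), (0 : Quat))
def oμ₂ : Octo := ((⟨0,0,1,0⟩ : Quat), (0 : Quat))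
def oμ₃ : Octo := ((⟨0,0,0,1⟩ : Quat), (0 : Quat))
def oμ₄ : Octo := ((0 : Quat), (1 : Quat))
def oμ₅ : Octo := ((0 : Quat), (⟨0,1,0,0⟩ : Quat))
def oμ₆ : Octo := ((0 : Quat), (⟨0,0,1,0⟩ : Quat))
def oμ₇ : Octo := ((0 : Quat), (⟨0,0,0,1⟩ : Quat))

/-- e^(μξ) = cos ξ + μ sin ξ, for an octonion imaginary unit μ. -/
def oexpIm (μ : Octo) (ξ : ℝ) : Octo :=
  Real.cos ξ • (((1 : Quat), (0 : Quat)) : Octo) + Real.sin ξ • μ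

/-- A real 2×2 matrix parameter A = (a,b;c,d). -/
structure LCTParams where
  a : ℝ
  b : ℝ
  c : ℝ
  d : ℝ

/-- A is unimodular: det A = 1. -/
def LCTParams.unimodular (P : LCTParams) : Prop := P.a * P.d - P.b * P.c = 1

/-- The inverse parameter matrix A⁻¹ = (d,−b;−c,a). -/
def LCTParams.inv (P : LCTParams) : LCTParams := ⟨P.d, -P.b, -P.c, P.a⟩

/-- The LCT kernel K^μ_A(x,w) = (2π|b|)^{-1/2} e^{(μ/2b)(ax² − 2xw + dw² − π/2)}. -/
def kern (μ : Octo) (P : LCTParams) (x w : ℝ) : Octo :=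
  (Real.sqrt (2 * π * |P.b|))⁻¹ •
    oexpIm μ ((1 / (2 * P.b)) * (P.a * x ^ 2 - 2 * x * w + P.d * w ^ 2 - π / 2))

/-- 3-dimensional Euclidean space. -/
abbrev R3 : Type := EuclideanSpace ℝ (Fin 3)

/-- The product K^{μ₁}_{A₁}(x₁,w₁)K^{μ₂}_{A₂}(x₂,w₂)K^{μ₄}_{A₃}(x₃,w₃),
multiplied from left to right. -/
def kprod (P₁ P₂ P₃ : LCTParams) (x w : R3) : Octo :=
  omul (omul (kern oμ₁ P₁ (x 0) (w 0)) (kern oμ₂ P₂ (x 1) (w 1))) (kern oμ₄ P₃ (x 2) (w 2))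

/-- The octonion linear canonical transform of a real-valued function on ℝ³. -/
def OLCT (P₁ P₂ P₃ : LCTParams) (f : R3 → ℝ) (w : R3) : Octo :=
  ∫ x : R3, f x • kprod P₁ P₂ P₃ x w

/-- The short-time octonion linear canonical transform of a real-valued
function f with real-valued window φ. -/
def STOLCT (P₁ P₂ P₃ : LCTParams) (φ f : R3 → ℝ) (w u : R3) : Octo :=
  ∫ x : R3, (f x * φ (x - u)) • kprod P₁ P₂ P₃ x w


open scoped FourierTransform SchwartzMap

lemma aux_expI_temperate :
    Function.HasTemperateGrowth (fun t : ℝ => Complex.exp (t * Complex.I)) := by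
  have hd : ∀ n : ℕ, iteratedDeriv n (fun t : ℝ => Complex.exp (t * Complex.I)) =
      fun t : ℝ => Complex.I ^ n * Complex.exp (t * Complex.I) := by
    intro n
    induction n with
    | zero => simp
    | succ n ih =>
      rw [iteratedDeriv_succ, ih]
      funext t
      have h1 : HasDerivAt (fun t : ℝ => (t : ℂ) * Complex.I) Complex.I t := by
        simpa using (Complex.ofRealCLM.hasDerivAt (x := t)).mul_const Complex.I
      have h2 := (h1.cexp).const_mul (Complex.I ^ n)
      rw [h2.deriv]
      ring
  refine ⟨?_, ?_⟩
  · exact Complex.contDiff_exp.comp (Complex.ofRealCLM.contDiff.mul contDiff_const)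
  · intro n
    refine ⟨0, 1, fun x => ?_⟩
    rw [norm_iteratedFDeriv_eq_norm_iteratedDeriv, hd]
    simp [Complex.norm_exp_ofReal_mul_I]

lemma aux_chirp (Q : R3 → ℝ) (hQ : Function.HasTemperateGrowth Q) (f : 𝓢(R3, ℝ)) :
    ∃ F : 𝓢(R3, ℂ), ∀ x, F x = (f x : ℂ) * Complex.exp (Q x * Complex.I) := by
  have h : Function.HasTemperateGrowth (fun x => Complex.exp (Q x * Complex.I)) :=
    aux_expI_temperate.comp hQ
  refine ⟨SchwartzMap.smulLeftCLM ℂ (fun x => Complex.exp (Q x * Complex.I))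
    (SchwartzMap.postcompCLM (𝕜 := ℝ) Complex.ofRealCLM f), fun x => ?_⟩
  rw [SchwartzMap.smulLeftCLM_apply_apply h]
  simp [SchwartzMap.postcompCLM_apply, mul_comm]

lemma aux_prod (F φ : 𝓢(R3, ℂ)) (u : R3) :
    ∃ h : 𝓢(R3, ℂ), ∀ x, h x = F x * φ (x - u) :=
  ⟨SchwartzMap.pairing (ContinuousLinearMap.mul ℝ ℂ) F (φ.compSubConstCLM ℝ u), fun x => by
    simp⟩

lemma aux_prodR (F φ : 𝓢(R3, ℝ)) (u : R3) :
    ∃ h : 𝓢(R3, ℝ), ∀ x, h x = F x * φ (x - u) :=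
  ⟨SchwartzMap.pairing (ContinuousLinearMap.mul ℝ ℝ) F (φ.compSubConstCLM ℝ u), fun x => by
    simp⟩

lemma aux_L1 (F φ : 𝓢(R3, ℂ)) (n : ℕ) :
    ∃ C : ℝ, ∀ u : R3, ∫ x, ‖iteratedFDeriv ℝ n (fun x => F x * φ (x - u)) x‖ ≤ C := by
  refine ⟨∫ x, ∑ i ∈ Finset.range (n + 1),
      (n.choose i : ℝ) * ‖iteratedFDeriv ℝ i F x‖ * SchwartzMap.seminorm ℝ 0 (n - i) φ,
      fun u => ?_⟩
  refine integral_mono_of_nonneg (Filter.Eventually.of_forall fun x => norm_nonneg _) ?_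
    (Filter.Eventually.of_forall fun x => ?_)
  · refine integrable_finsetSum _ fun i _ => Integrable.mul_const (Integrable.const_mul ?_ _) _
    simpa using F.integrable_pow_mul_iteratedFDeriv volume 0 i
  · refine (norm_iteratedFDeriv_mul_le (N := (⊤ : ℕ∞)) (F.smooth ⊤)
      ((φ.smooth ⊤).comp (contDiff_id.sub contDiff_const)) x (mod_cast le_top)).trans ?_
    refine Finset.sum_le_sum fun i _ => ?_
    gcongr
    have := φ.norm_iteratedFDeriv_le_seminorm ℝ (n - i) (x - u)
    have h2 := iteratedFDeriv_comp_sub (𝕜 := ℝ) (f := (φ : R3 → ℂ)) (n - i) u x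
    simp only [id, Function.comp_def] at h2 ⊢
    rw [h2]
    exact this

lemma aux_fourier (F φ : 𝓢(R3, ℂ)) (n : ℕ) :
    ∃ C : ℝ, ∀ u ξ : R3, ‖ξ‖ ^ n * ‖𝓕 (fun x => F x * φ (x - u)) ξ‖ ≤ C := by
  choose C hC using aux_L1 F φ
  refine ⟨2 ^ n * ∑ i ∈ Finset.range (n + 1), C i, fun u ξ => ?_⟩
  obtain ⟨h, hh⟩ := aux_prod F φ u
  have hfun : (fun x => F x * φ (x - u)) = h := by funext x; exact (hh x).symm
  have key := Real.pow_mul_norm_iteratedFDeriv_fourier_le (K := ⊤) (N := ⊤) (f := h)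
    (h.smooth ⊤) (fun k n _ _ => h.integrable_pow_mul_iteratedFDeriv volume k n)
    (k := 0) (n := n) le_top le_top ξ
  rw [hfun]
  simp only [norm_iteratedFDeriv_zero] at key
  refine key.trans ?_
  rw [Finset.sum_product]
  simp only [pow_zero, Nat.cast_zero, mul_zero, zero_add, one_mul, Finset.range_one,
    Finset.sum_singleton]
  gcongr with i hi
  have := hC i u
  rwa [hfun] at this

lemma aux_cos (Q : R3 → ℝ) (hQ : Function.HasTemperateGrowth Q) (f φ : 𝓢(R3, ℝ)) :
    ∃ C : ℝ, ∀ (u v : R3) (c : ℝ),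
      (1 + ‖v‖ ^ 6) * |∫ x, f x * φ (x - u) * Real.cos (Q x + inner ℝ x v + c)| ≤ C := by
  obtain ⟨F, hF⟩ := aux_chirp Q hQ f
  set ψ : 𝓢(R3, ℂ) := SchwartzMap.postcompCLM (𝕜 := ℝ) Complex.ofRealCLM φ with hψ
  have hψx : ∀ x, ψ x = (φ x : ℂ) := fun x => by simp [hψ, SchwartzMap.postcompCLM_apply]
  obtain ⟨C0, h0⟩ := aux_fourier F ψ 0
  obtain ⟨C6, h6⟩ := aux_fourier F ψ 6
  refine ⟨C0 + (2 * π) ^ 6 * C6, fun u v c => ?_⟩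
  set ξ : R3 := (-(2 * π)⁻¹) • v with hξ
  have hv : ‖v‖ = (2 * π) * ‖ξ‖ := by
    rw [hξ, norm_smul, norm_neg, norm_inv, Real.norm_of_nonneg (by positivity)]
    field_simp
  have e1 : ∫ x, f x * φ (x - u) * Real.cos (Q x + inner ℝ x v + c) =
      (Complex.exp (c * Complex.I) * 𝓕 (fun x => F x * ψ (x - u)) ξ).re := by
    rw [Real.fourier_eq', ← integral_const_mul]
    obtain ⟨h, hh⟩ := aux_prod F ψ u
    have hInt8 : Integrable (fun x => Complex.exp (c * Complex.I) *
        (Complex.exp (↑(-2 * π * inner ℝ x ξ) * Complex.I) • (F x * ψ (x - u)))) := by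
      refine Integrable.const_mul ?_ _
      refine (h.integrable (μ := volume)).mono ?_ ?_
      · refine Continuous.aestronglyMeasurable ?_
        have := F.continuous
        have := ψ.continuous
        fun_prop
      · refine Filter.Eventually.of_forall fun x => ?_
        rw [norm_smul, Complex.norm_exp_ofReal_mul_I, one_mul, hh]
    have := integral_re hInt8
    simp only [RCLike.re_to_complex] at this
    rw [← this]
    refine integral_congr_ae (Filter.Eventually.of_forall fun x => ?_)
    simp only [hF, hψx, smul_eq_mul]
    have e2 : (-2 * π * inner ℝ x ξ : ℝ) = inner ℝ x v := by
      rw [hξ, inner_smul_right]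
      field_simp
    rw [e2]
    have e3 : Complex.exp (c * Complex.I) * (Complex.exp ((inner ℝ x v : ℝ) * Complex.I) *
        ((f x : ℂ) * Complex.exp (Q x * Complex.I) * (φ (x - u) : ℂ))) =
        ((f x * φ (x - u) : ℝ) : ℂ) * Complex.exp (((Q x + inner ℝ x v + c : ℝ) : ℂ) * Complex.I) := by
      push_cast
      rw [add_mul, add_mul, Complex.exp_add, Complex.exp_add]
      ring
    rw [e3, Complex.re_ofReal_mul, Complex.exp_ofReal_mul_I_re]
  have e4 : |∫ x, f x * φ (x - u) * Real.cos (Q x + inner ℝ x v + c)| ≤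
      ‖𝓕 (fun x => F x * ψ (x - u)) ξ‖ := by
    rw [e1]
    refine (Complex.abs_re_le_norm _).trans ?_
    rw [norm_mul, Complex.norm_exp_ofReal_mul_I, one_mul]
  have a0 := h0 u ξ
  have a6 := h6 u ξ
  rw [pow_zero, one_mul] at a0
  calc _ ≤ (1 + ‖v‖ ^ 6) * ‖𝓕 (fun x => F x * ψ (x - u)) ξ‖ := by gcongr
    _ = ‖𝓕 (fun x => F x * ψ (x - u)) ξ‖ +
        (2 * π) ^ 6 * (‖ξ‖ ^ 6 * ‖𝓕 (fun x => F x * ψ (x - u)) ξ‖) := by rw [hv]; ring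
    _ ≤ _ := by gcongr

/-- Phase of the kernel. -/
def aux_ph (P : LCTParams) (x w : ℝ) : ℝ :=
  (1 / (2 * P.b)) * (P.a * x ^ 2 - 2 * x * w + P.d * w ^ 2 - π / 2)

lemma aux_signed (P₁ P₂ P₃ : LCTParams)
    (hb₁ : P₁.b ≠ 0) (hb₂ : P₂.b ≠ 0) (hb₃ : P₃.b ≠ 0) (f φ : 𝓢(R3, ℝ))
    (s t : ℝ) (hs : s ^ 2 = 1) (ht : t ^ 2 = 1) :
    ∃ C : ℝ, ∀ (u w : R3) (c : ℝ),
      (1 + ‖w‖ ^ 6) * |∫ x : R3, f x * φ (x - u) * Real.cos (aux_ph P₁ (x 0) (w 0) +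
        s * aux_ph P₂ (x 1) (w 1) + t * aux_ph P₃ (x 2) (w 2) + c)| ≤ C := by
  set Q : R3 → ℝ := fun x => P₁.a / (2 * P₁.b) * (x 0) ^ 2 + s * P₂.a / (2 * P₂.b) * (x 1) ^ 2 +
    t * P₃.a / (2 * P₃.b) * (x 2) ^ 2 with hQdef
  have hc : ∀ i : Fin 3, Function.HasTemperateGrowth (fun x : R3 => x i) := fun i =>
    (EuclideanSpace.proj (𝕜 := ℝ) i : R3 →L[ℝ] ℝ).hasTemperateGrowth
  have hQ : Function.HasTemperateGrowth Q := by
    have h := fun i => (hc i).pow 2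
    have h' := fun (i : Fin 3) (r : ℝ) => (Function.HasTemperateGrowth.const (E := R3) r).mul (h i)
    exact ((h' 0 _).add (h' 1 _)).add (h' 2 _)
  obtain ⟨C, hC⟩ := aux_cos Q hQ f φ
  set M : ℝ := 1 + P₁.b ^ 2 + P₂.b ^ 2 + P₃.b ^ 2 with hM
  have hM1 : 1 ≤ M := by rw [hM]; nlinarith [sq_nonneg P₁.b, sq_nonneg P₂.b, sq_nonneg P₃.b]
  refine ⟨M ^ 3 * C, fun u w c => ?_⟩
  set v : R3 := !₂[-(w 0) / P₁.b, -s * (w 1) / P₂.b, -t * (w 2) / P₃.b] with hv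
  have hwv : ‖w‖ ^ 2 ≤ M * ‖v‖ ^ 2 := by
    rw [EuclideanSpace.norm_sq_eq, EuclideanSpace.norm_sq_eq]
    simp only [Fin.sum_univ_three, Real.norm_eq_abs, sq_abs]
    have q0 : (w 0) ^ 2 = P₁.b ^ 2 * (v 0) ^ 2 := by simp [hv]; field_simp
    have q1 : (w 1) ^ 2 = P₂.b ^ 2 * (v 1) ^ 2 := by
      simp [hv]; field_simp; rw [hs]; ring
    have q2 : (w 2) ^ 2 = P₃.b ^ 2 * (v 2) ^ 2 := by
      simp [hv]; field_simp; rw [ht]; ring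
    rw [q0, q1, q2]
    have := sq_nonneg P₁.b
    have := sq_nonneg P₂.b
    have := sq_nonneg P₃.b
    have l0 : P₁.b ^ 2 ≤ M := by linarith
    have l1 : P₂.b ^ 2 ≤ M := by linarith
    have l2 : P₃.b ^ 2 ≤ M := by linarith
    rw [mul_add, mul_add]
    gcongr
  have hw6 : 1 + ‖w‖ ^ 6 ≤ M ^ 3 * (1 + ‖v‖ ^ 6) := by
    have h1 : (‖w‖ ^ 2) ^ 3 ≤ (M * ‖v‖ ^ 2) ^ 3 := by gcongr
    have h2 : 1 ≤ M ^ 3 := one_le_pow₀ hM1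
    nlinarith
  obtain ⟨c', hc'⟩ : ∃ c' : ℝ, ∀ x : R3, aux_ph P₁ (x 0) (w 0) +
        s * aux_ph P₂ (x 1) (w 1) + t * aux_ph P₃ (x 2) (w 2) + c = Q x + inner ℝ x v + c' := by
    refine ⟨c + (1 / (2 * P₁.b)) * (P₁.d * (w 0) ^ 2 - π / 2) +
      s * ((1 / (2 * P₂.b)) * (P₂.d * (w 1) ^ 2 - π / 2)) +
      t * ((1 / (2 * P₃.b)) * (P₃.d * (w 2) ^ 2 - π / 2)), fun x => ?_⟩
    simp only [hQdef, aux_ph, PiLp.inner_apply, Fin.sum_univ_three, hv]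
    simp
    field_simp
    ring
  simp only [hc']
  calc _ ≤ M ^ 3 * (1 + ‖v‖ ^ 6) *
        |∫ x, f x * φ (x - u) * Real.cos (Q x + inner ℝ x v + c')| := by gcongr
    _ = M ^ 3 * ((1 + ‖v‖ ^ 6) *
        |∫ x, f x * φ (x - u) * Real.cos (Q x + inner ℝ x v + c')|) := by ring
    _ ≤ _ := by gcongr; exact hC u v c'

lemma aux_trig (A B C : ℝ) : Real.cos A * Real.cos B * Real.cos C =
    (1 / 4) * (Real.cos (A + 1 * B + 1 * C) + Real.cos (A + 1 * B + (-1) * C) +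
      Real.cos (A + (-1) * B + 1 * C) + Real.cos (A + (-1) * B + (-1) * C)) := by
  simp only [one_mul, neg_mul, Real.cos_add, Real.sin_add, Real.cos_neg, Real.sin_neg]
  ring

/-- The phase shifts. -/
def aux_dl : Fin 2 → ℝ := ![0, π / 2]

/-- One scalar component of the kernel product. -/
def aux_t (P₁ P₂ P₃ : LCTParams) (i j k : Fin 2) (x w : R3) : ℝ :=
  Real.cos (aux_ph P₁ (x 0) (w 0) - aux_dl i) * Real.cos (aux_ph P₂ (x 1) (w 1) - aux_dl j) *
    Real.cos (aux_ph P₃ (x 2) (w 2) - aux_dl k)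

lemma aux_t_le (P₁ P₂ P₃ : LCTParams) (i j k : Fin 2) (x w : R3) :
    |aux_t P₁ P₂ P₃ i j k x w| ≤ 1 := by
  unfold aux_t
  rw [abs_mul, abs_mul]
  have h := fun y => Real.abs_cos_le_one y
  exact mul_le_one₀ (mul_le_one₀ (h _) (abs_nonneg _) (h _)) (abs_nonneg _) (h _)

lemma aux_t_cont {X : Type*} [TopologicalSpace X] (P₁ P₂ P₃ : LCTParams) (i j k : Fin 2)
    (a b : X → R3) (ha : Continuous a) (hb : Continuous b) :
    Continuous (fun p : X => aux_t P₁ P₂ P₃ i j k (a p) (b p)) := by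
  unfold aux_t aux_ph
  fun_prop

lemma aux_int_bdd (f φ : 𝓢(R3, ℝ)) (u : R3) (t : R3 → ℝ) (ht : Continuous t)
    (h1 : ∀ x, |t x| ≤ 1) : Integrable (fun x => f x * φ (x - u) * t x) := by
  obtain ⟨h, hh⟩ := aux_prodR f φ u
  refine (h.integrable (μ := volume)).mono ?_ (Filter.Eventually.of_forall fun x => ?_)
  · refine Continuous.aestronglyMeasurable ?_
    have := f.continuous
    have := φ.continuous
    fun_prop
  · rw [hh, norm_mul]
    exact mul_le_of_le_one_right (norm_nonneg _) (h1 x)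

lemma aux_comp (P₁ P₂ P₃ : LCTParams)
    (hb₁ : P₁.b ≠ 0) (hb₂ : P₂.b ≠ 0) (hb₃ : P₃.b ≠ 0) (f φ : 𝓢(R3, ℝ)) :
    ∃ C : ℝ, ∀ (u w : R3) (i j k : Fin 2),
      (1 + ‖w‖ ^ 6) * |∫ x : R3, f x * φ (x - u) * aux_t P₁ P₂ P₃ i j k x w| ≤ C := by
  obtain ⟨C1, h1⟩ := aux_signed P₁ P₂ P₃ hb₁ hb₂ hb₃ f φ 1 1 (by norm_num) (by norm_num)
  obtain ⟨C2, h2⟩ := aux_signed P₁ P₂ P₃ hb₁ hb₂ hb₃ f φ 1 (-1) (by norm_num) (by norm_num)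
  obtain ⟨C3, h3⟩ := aux_signed P₁ P₂ P₃ hb₁ hb₂ hb₃ f φ (-1) 1 (by norm_num) (by norm_num)
  obtain ⟨C4, h4⟩ := aux_signed P₁ P₂ P₃ hb₁ hb₂ hb₃ f φ (-1) (-1) (by norm_num) (by norm_num)
  refine ⟨C1 + C2 + C3 + C4, fun u w i j k => ?_⟩
  set I : ℝ → ℝ → R3 → ℝ := fun s t x => f x * φ (x - u) *
    Real.cos (aux_ph P₁ (x 0) (w 0) + s * aux_ph P₂ (x 1) (w 1) + t * aux_ph P₃ (x 2) (w 2) +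
      (-aux_dl i - s * aux_dl j - t * aux_dl k)) with hI
  have hInt8 : ∀ s t, Integrable (I s t) := by
    intro s t
    refine aux_int_bdd f φ u _ ?_ (fun x => Real.abs_cos_le_one _)
    unfold aux_ph
    fun_prop
  have e : ∫ x : R3, f x * φ (x - u) * aux_t P₁ P₂ P₃ i j k x w =
      (1 / 4) * ((∫ x, I 1 1 x) + (∫ x, I 1 (-1) x) + (∫ x, I (-1) 1 x) +
        (∫ x, I (-1) (-1) x)) := by
    have i2 : Integrable (fun x => I 1 1 x + I 1 (-1) x) := (hInt8 _ _).add (hInt8 _ _)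
    have i3 : Integrable (fun x => I 1 1 x + I 1 (-1) x + I (-1) 1 x) := i2.add (hInt8 _ _)
    rw [← integral_add (hInt8 _ _) (hInt8 _ _), ← integral_add i2 (hInt8 _ _),
      ← integral_add i3 (hInt8 _ _), ← integral_const_mul]
    refine integral_congr_ae (Filter.Eventually.of_forall fun x => ?_)
    simp only [aux_t, aux_trig, hI]
    have r : ∀ a b c d e g s t : ℝ, a - d + s * (b - e) + t * (c - g) =
      a + s * b + t * c + (-d - s * e - t * g) := by intros; ring
    simp only [r]
    ring
  have g1 := h1 u w (-aux_dl i - 1 * aux_dl j - 1 * aux_dl k)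
  have g2 := h2 u w (-aux_dl i - 1 * aux_dl j - (-1) * aux_dl k)
  have g3 := h3 u w (-aux_dl i - (-1) * aux_dl j - 1 * aux_dl k)
  have g4 := h4 u w (-aux_dl i - (-1) * aux_dl j - (-1) * aux_dl k)
  have hp : 0 ≤ 1 + ‖w‖ ^ 6 := by positivity
  change (1 + ‖w‖ ^ 6) * |∫ x, I 1 1 x| ≤ C1 at g1
  change (1 + ‖w‖ ^ 6) * |∫ x, I 1 (-1) x| ≤ C2 at g2
  change (1 + ‖w‖ ^ 6) * |∫ x, I (-1) 1 x| ≤ C3 at g3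
  change (1 + ‖w‖ ^ 6) * |∫ x, I (-1) (-1) x| ≤ C4 at g4
  rw [e]
  have tri : |(1 / 4) * ((∫ x, I 1 1 x) + (∫ x, I 1 (-1) x) + (∫ x, I (-1) 1 x) +
        (∫ x, I (-1) (-1) x))| ≤ |∫ x, I 1 1 x| + |∫ x, I 1 (-1) x| + |∫ x, I (-1) 1 x| +
        |∫ x, I (-1) (-1) x| := by
    rw [abs_mul, abs_of_pos (by norm_num : (0 : ℝ) < 1 / 4)]
    have q1 := abs_add_le ((∫ x, I 1 1 x) + (∫ x, I 1 (-1) x) + (∫ x, I (-1) 1 x))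
        (∫ x, I (-1) (-1) x)
    have q2 := abs_add_le ((∫ x, I 1 1 x) + (∫ x, I 1 (-1) x)) (∫ x, I (-1) 1 x)
    have q3 := abs_add_le ((∫ x, I 1 1 x)) (∫ x, I 1 (-1) x)
    have q4 := abs_nonneg ((∫ x, I 1 1 x) + (∫ x, I 1 (-1) x) + (∫ x, I (-1) 1 x) +
      (∫ x, I (-1) (-1) x))
    linarith
  have := mul_le_mul_of_nonneg_left tri hp
  linarith

lemma aux_omul8 (I J : Quat) (ca sa cb sb cc sc n1 n2 n3 : ℝ) :
    omul (omul (n1 • (ca • ((1 : Quat), (0 : Quat)) + sa • ((I, 0) : Octo)))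
      (n2 • (cb • ((1 : Quat), (0 : Quat)) + sb • ((J, 0) : Octo))))
      (n3 • (cc • ((1 : Quat), (0 : Quat)) + sc • ((0 : Quat), (1 : Quat)))) =
      (((ca * cb * cc) • (n1 * n2 * n3) •
        omul (omul ((1 : Quat), (0 : Quat)) ((1 : Quat), (0 : Quat))) ((1 : Quat), (0 : Quat)) +
      (ca * cb * sc) • (n1 * n2 * n3) •
        omul (omul ((1 : Quat), (0 : Quat)) ((1 : Quat), (0 : Quat))) ((0 : Quat), (1 : Quat))) +
      ((ca * sb * cc) • (n1 * n2 * n3) •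
        omul (omul ((1 : Quat), (0 : Quat)) ((J, 0) : Octo)) ((1 : Quat), (0 : Quat)) +
      (ca * sb * sc) • (n1 * n2 * n3) •
        omul (omul ((1 : Quat), (0 : Quat)) ((J, 0) : Octo)) ((0 : Quat), (1 : Quat)))) +
      (((sa * cb * cc) • (n1 * n2 * n3) •
        omul (omul ((I, 0) : Octo) ((1 : Quat), (0 : Quat))) ((1 : Quat), (0 : Quat)) +
      (sa * cb * sc) • (n1 * n2 * n3) •
        omul (omul ((I, 0) : Octo) ((1 : Quat), (0 : Quat))) ((0 : Quat), (1 : Quat))) +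
      ((sa * sb * cc) • (n1 * n2 * n3) •
        omul (omul ((I, 0) : Octo) ((J, 0) : Octo)) ((1 : Quat), (0 : Quat)) +
      (sa * sb * sc) • (n1 * n2 * n3) •
        omul (omul ((I, 0) : Octo) ((J, 0) : Octo)) ((0 : Quat), (1 : Quat)))) := by
  have hs : ∀ r : ℝ, star (r • (1 : Quat)) = r • (1 : Quat) := fun r => by
    rw [Quaternion.star_smul, star_one]
  refine Prod.ext ?_ ?_
  · simp only [omul, Prod.fst_add, Prod.snd_add, Prod.smul_fst, Prod.smul_snd, smul_zero, add_zero,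
      zero_add, star_zero, mul_zero, zero_mul, sub_zero, mul_one, one_mul, smul_add, smul_smul, hs,
      star_one, mul_add, add_mul, smul_mul_assoc, mul_smul_comm]
    module
  · simp only [omul, Prod.fst_add, Prod.snd_add, Prod.smul_fst, Prod.smul_snd, smul_zero, add_zero,
      zero_add, star_zero, mul_zero, zero_mul, sub_zero, mul_one, one_mul, smul_add, smul_smul, hs,
      star_one, mul_add, add_mul, smul_mul_assoc, mul_smul_comm]
    module

lemma aux_kprod (P₁ P₂ P₃ : LCTParams) :
    ∃ E : Fin 2 → Fin 2 → Fin 2 → Octo, ∀ x w, kprod P₁ P₂ P₃ x w =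
      ∑ i, ∑ j, ∑ k, aux_t P₁ P₂ P₃ i j k x w • E i j k := by
  refine ⟨fun i j k => ((Real.sqrt (2 * π * |P₁.b|))⁻¹ * (Real.sqrt (2 * π * |P₂.b|))⁻¹ *
    (Real.sqrt (2 * π * |P₃.b|))⁻¹) • omul (omul ((![((1 : Quat), (0 : Quat)), oμ₁] : Fin 2 → Octo) i)
      ((![((1 : Quat), (0 : Quat)), oμ₂] : Fin 2 → Octo) j))
      ((![((1 : Quat), (0 : Quat)), oμ₄] : Fin 2 → Octo) k), fun x w => ?_⟩
  simp only [Fin.sum_univ_two, kprod, kern, oexpIm, aux_t, aux_dl]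
  simp only [Matrix.cons_val_zero, Matrix.cons_val_one, sub_zero, Real.cos_sub_pi_div_two]
  simp only [← aux_ph.eq_1]
  generalize aux_ph P₁ (x 0) (w 0) = a
  generalize aux_ph P₂ (x 1) (w 1) = b
  generalize aux_ph P₃ (x 2) (w 2) = c
  generalize (Real.sqrt (2 * π * |P₁.b|))⁻¹ = n1
  generalize (Real.sqrt (2 * π * |P₂.b|))⁻¹ = n2
  generalize (Real.sqrt (2 * π * |P₃.b|))⁻¹ = n3
  exact aux_omul8 _ _ _ _ _ _ _ _ _ _ _

lemma aux_onorm_sq (x : Octo) : onorm x ^ 2 ≤ 2 * ‖x‖ ^ 2 := by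
  unfold onorm
  rw [Real.sq_sqrt (by positivity)]
  have h1 : ‖x.1‖ ^ 2 ≤ ‖x‖ ^ 2 := by gcongr; exact norm_fst_le x
  have h2 : ‖x.2‖ ^ 2 ≤ ‖x‖ ^ 2 := by gcongr; exact norm_snd_le x
  linarith

lemma aux_onorm_cont : Continuous onorm := by
  unfold onorm
  fun_prop

lemma aux_sum_int {V : Type*} [NormedAddCommGroup V] [NormedSpace ℝ V] [CompleteSpace V]
    (g : R3 → ℝ)
    (t : Fin 2 → Fin 2 → Fin 2 → R3 → ℝ) (E : Fin 2 → Fin 2 → Fin 2 → V)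
    (ht : ∀ i j k, Integrable (fun x => g x * t i j k x)) :
    ∫ x, g x • ∑ i, ∑ j, ∑ k, t i j k x • E i j k =
      ∑ i, ∑ j, ∑ k, (∫ x, g x * t i j k x) • E i j k := by
  have hInt8 : ∀ i j k, Integrable (fun x => (g x * t i j k x) • E i j k) :=
    fun i j k => (ht i j k).smul_const _
  simp only [Finset.smul_sum, smul_smul]
  rw [integral_finsetSum _ (fun i _ => integrable_finsetSum _ fun j _ =>
    integrable_finsetSum _ fun k _ => hInt8 i j k)]
  refine Finset.sum_congr rfl fun i _ => ?_
  rw [integral_finsetSum _ (fun j _ => integrable_finsetSum _ fun k _ => hInt8 i j k)]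
  refine Finset.sum_congr rfl fun j _ => ?_
  rw [integral_finsetSum _ (fun k _ => hInt8 i j k)]
  refine Finset.sum_congr rfl fun k _ => ?_
  rw [integral_smul_const]

lemma aux_sum_norm {V : Type*} [NormedAddCommGroup V] [NormedSpace ℝ V]
    (t : Fin 2 → Fin 2 → Fin 2 → ℝ) (E : Fin 2 → Fin 2 → Fin 2 → V) (C p : ℝ) (hp : 0 ≤ p)
    (ht : ∀ i j k, p * |t i j k| ≤ C) :
    p * ‖∑ i, ∑ j, ∑ k, t i j k • E i j k‖ ≤ ∑ i, ∑ j, ∑ k, C * ‖E i j k‖ := by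
  refine (mul_le_mul_of_nonneg_left ((norm_sum_le _ _).trans (Finset.sum_le_sum fun i _ =>
    (norm_sum_le _ _).trans (Finset.sum_le_sum fun j _ => norm_sum_le _ _))) hp).trans ?_
  simp only [Finset.mul_sum]
  refine Finset.sum_le_sum fun i _ => Finset.sum_le_sum fun j _ => Finset.sum_le_sum fun k _ => ?_
  rw [norm_smul, ← mul_assoc]
  exact mul_le_mul_of_nonneg_right (ht i j k) (norm_nonneg _)

lemma aux_sum_cont {V X : Type*} [NormedAddCommGroup V] [NormedSpace ℝ V] [TopologicalSpace X]
    (g : X → ℝ) (hg : Continuous g)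
    (t : Fin 2 → Fin 2 → Fin 2 → X → ℝ) (E : Fin 2 → Fin 2 → Fin 2 → V)
    (ht : ∀ i j k, Continuous (t i j k)) :
    Continuous (fun x => g x • ∑ i, ∑ j, ∑ k, t i j k x • E i j k) := by
  refine hg.smul (continuous_finsetSum _ fun i _ => continuous_finsetSum _ fun j _ =>
    continuous_finsetSum _ fun k _ => (ht i j k).smul continuous_const)

lemma aux_ST_w (P₁ P₂ P₃ : LCTParams)
    (hb₁ : P₁.b ≠ 0) (hb₂ : P₂.b ≠ 0) (hb₃ : P₃.b ≠ 0) (f φ : 𝓢(R3, ℝ)) :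
    ∃ C : ℝ, ∀ (u w : R3), (1 + ‖w‖ ^ 6) * ‖STOLCT P₁ P₂ P₃ φ f w u‖ ≤ C := by
  obtain ⟨E, hE⟩ := aux_kprod P₁ P₂ P₃
  obtain ⟨C, hC⟩ := aux_comp P₁ P₂ P₃ hb₁ hb₂ hb₃ f φ
  refine ⟨∑ i, ∑ j, ∑ k, C * ‖E i j k‖, fun u w => ?_⟩
  have e : STOLCT P₁ P₂ P₃ φ f w u =
      ∑ i, ∑ j, ∑ k, (∫ x, f x * φ (x - u) * aux_t P₁ P₂ P₃ i j k x w) • E i j k := by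
    rw [STOLCT, ← aux_sum_int (fun x => f x * φ (x - u))
      (fun i j k x => aux_t P₁ P₂ P₃ i j k x w) E]
    · refine integral_congr_ae (Filter.Eventually.of_forall fun x => ?_)
      exact congrArg (fun z => (f x * φ (x - u)) • z) (hE x w)
    · intro i j k
      refine aux_int_bdd f φ u _ ?_ (fun x => aux_t_le ..)
      exact aux_t_cont P₁ P₂ P₃ i j k _ _ continuous_id continuous_const
  rw [e]
  exact aux_sum_norm _ E C _ (by positivity) (fun i j k => hC u w i j k)

lemma aux_ST_u (P₁ P₂ P₃ : LCTParams) (f φ : 𝓢(R3, ℝ)) :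
    ∃ C : ℝ, ∀ (u w : R3), ‖STOLCT P₁ P₂ P₃ φ f w u‖ ≤ C * ∫ x, |f x| * |φ (x - u)| := by
  obtain ⟨E, hE⟩ := aux_kprod P₁ P₂ P₃
  refine ⟨∑ i, ∑ j, ∑ k, ‖E i j k‖, fun u w => ?_⟩
  unfold STOLCT
  rw [← integral_const_mul]
  obtain ⟨h, hh⟩ := aux_prodR f φ u
  refine norm_integral_le_of_norm_le ?_ (Filter.Eventually.of_forall fun x => ?_)
  · refine Integrable.const_mul ?_ _
    refine (h.integrable (μ := volume)).norm.congr (Filter.Eventually.of_forall fun x => ?_)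
    simp [hh]
  · rw [norm_smul, norm_mul, mul_comm, Real.norm_eq_abs, Real.norm_eq_abs]
    refine mul_le_mul_of_nonneg_right ?_ (by positivity)
    rw [hE]
    have := aux_sum_norm (fun i j k => aux_t P₁ P₂ P₃ i j k x w) E 1 1 zero_le_one
      (fun i j k => by rw [one_mul]; exact aux_t_le ..)
    simpa only [one_mul] using this

lemma aux_log_int : Integrable (fun w : R3 => |Real.log ‖w‖| * (1 + ‖w‖ ^ 6)⁻¹) := by
  have := integrable_fun_norm_addHaar (volume : Measure R3)
    (f := fun y : ℝ => |Real.log y| * (1 + y ^ 6)⁻¹)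
  rw [this]
  have hf : Module.finrank ℝ R3 = 3 := by simp
  rw [hf]
  have hd : Integrable (fun y : ℝ => 2 * (1 + y ^ 2)⁻¹) := integrable_inv_one_add_sq.const_mul 2
  refine hd.integrableOn.mono' ?_ ?_
  · refine Measurable.aestronglyMeasurable ?_
    fun_prop
  · refine (ae_restrict_iff' measurableSet_Ioi).2 (Filter.Eventually.of_forall fun y hy => ?_)
    have hy : 0 < y := hy
    have hl : |Real.log y| ≤ y + y⁻¹ := by
      rw [abs_le]
      have h1 := Real.log_le_sub_one_of_pos hy
      have h2 := Real.log_le_sub_one_of_pos (inv_pos.2 hy)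
      rw [Real.log_inv] at h2
      have := inv_pos.2 hy
      constructor <;> linarith
    rw [smul_eq_mul, Real.norm_of_nonneg (by positivity)]
    calc y ^ (3 - 1) * (|Real.log y| * (1 + y ^ 6)⁻¹)
        ≤ y ^ 2 * ((y + y⁻¹) * (1 + y ^ 6)⁻¹) := by norm_num; gcongr
      _ = (y ^ 3 + y) / (1 + y ^ 6) := by field_simp
      _ ≤ 2 / (1 + y ^ 2) := by
        rw [div_le_div_iff₀ (by positivity) (by positivity)]
        have a1 : 2 * y ^ 3 ≤ 1 + y ^ 6 := by nlinarith [sq_nonneg (y ^ 3 - 1)]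
        have a2 : y ≤ (1 + y ^ 2) / 2 := by nlinarith [sq_nonneg (y - 1)]
        have a3 : y ^ 5 ≤ (y ^ 6 + y ^ 4) / 2 := by nlinarith [sq_nonneg (y ^ 3 - y ^ 2)]
        have a4 : 3 * y ^ 2 ≤ y ^ 6 + 2 := by
          nlinarith [sq_nonneg (y ^ 2 - 1), mul_nonneg (sq_nonneg (y ^ 2 - 1)) (sq_nonneg y)]
        have a5 : 3 * y ^ 4 ≤ 2 * y ^ 6 + 1 := by
          nlinarith [sq_nonneg (y ^ 2 - 1), mul_nonneg (sq_nonneg (y ^ 2 - 1)) (sq_nonneg y)]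
        nlinarith
      _ = 2 * (1 + y ^ 2)⁻¹ := by ring

lemma aux_log_schwartz (f : 𝓢(R3, ℝ)) : Integrable (fun x : R3 => Real.log ‖x‖ * f x ^ 2) := by
  obtain ⟨A, hA⟩ : ∃ A, ∀ x, |f x| ≤ A := ⟨_, fun x => f.norm_le_seminorm ℝ x⟩
  obtain ⟨B, hB⟩ : ∃ B, ∀ x, ‖x‖ ^ 6 * |f x| ≤ B := ⟨_, fun x => f.norm_pow_mul_le_seminorm ℝ 6 x⟩
  refine (aux_log_int.mul_const ((A + B) * A)).mono' ?_ (Filter.Eventually.of_forall fun x => ?_)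
  · have := f.continuous.measurable
    refine Measurable.aestronglyMeasurable ?_
    fun_prop
  · rw [norm_mul, Real.norm_eq_abs, Real.norm_of_nonneg (sq_nonneg _), mul_assoc]
    refine mul_le_mul_of_nonneg_left ?_ (abs_nonneg _)
    rw [← sq_abs, inv_mul_eq_div, le_div_iff₀ (by positivity)]
    have h1 := hA x
    have h2 := hB x
    have h0 := abs_nonneg (f x)
    calc |f x| ^ 2 * (1 + ‖x‖ ^ 6) = (|f x| + ‖x‖ ^ 6 * |f x|) * |f x| := by ring
      _ ≤ (A + B) * A := by
        refine mul_le_mul (by linarith) h1 h0 ?_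
        have : 0 ≤ ‖x‖ ^ 6 * |f x| := by positivity
        linarith

lemma aux_conv (a b : R3 → ℝ) (ha : Integrable a) (hb : Integrable b) :
    Integrable (fun p : R3 × R3 => a p.2 * b (p.2 - p.1)) (volume.prod volume) := by
  have := Integrable.convolution_integrand (ContinuousLinearMap.mul ℝ ℝ) ha hb.comp_neg
  simpa using this

lemma aux_J (P₁ P₂ P₃ : LCTParams)
    (hb₁ : P₁.b ≠ 0) (hb₂ : P₂.b ≠ 0) (hb₃ : P₃.b ≠ 0) (f φ : 𝓢(R3, ℝ)) :
    Integrable (fun p : R3 × R3 => Real.log ‖p.1‖ * onorm (STOLCT P₁ P₂ P₃ φ f p.1 p.2) ^ 2)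
      (volume.prod volume) := by
  obtain ⟨C1, h1⟩ := aux_ST_w P₁ P₂ P₃ hb₁ hb₂ hb₃ f φ
  obtain ⟨C2, h2⟩ := aux_ST_u P₁ P₂ P₃ f φ
  have hconv : Integrable (fun u => ∫ x, |f x| * |φ (x - u)|) :=
    (aux_conv (fun x => |f x|) (fun x => |φ x|) f.integrable.abs φ.integrable.abs).integral_prod_left
  have hdom := (aux_log_int.mul_prod (hconv.const_mul (2 * C1 * C2)))
  refine hdom.mono' ?_ (Filter.Eventually.of_forall fun p => ?_)
  · refine AEStronglyMeasurable.mul ?_ ?_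
    · refine Measurable.aestronglyMeasurable ?_
      fun_prop
    · refine StronglyMeasurable.aestronglyMeasurable ?_
      refine (continuous_pow 2).comp_stronglyMeasurable
        (aux_onorm_cont.comp_stronglyMeasurable ?_)
      unfold STOLCT
      refine StronglyMeasurable.integral_prod_right
        (f := fun (p : R3 × R3) (x : R3) => (f x * φ (x - p.2)) • kprod P₁ P₂ P₃ x p.1) ?_
      refine Continuous.stronglyMeasurable ?_
      obtain ⟨E, hE⟩ := aux_kprod P₁ P₂ P₃
      have hf := f.continuous
      have hφ := φ.continuous
      have ht : ∀ i j k, Continuous fun q : (R3 × R3) × R3 => aux_t P₁ P₂ P₃ i j k q.2 q.1.1 :=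
        fun i j k => aux_t_cont P₁ P₂ P₃ i j k _ _ (by fun_prop) (by fun_prop)
      have hg : Continuous fun q : (R3 × R3) × R3 => f q.2 * φ (q.2 - q.1.2) := by fun_prop
      refine (aux_sum_cont _ hg _ E ht).congr fun q => ?_
      exact congrArg (fun z => (f q.2 * φ (q.2 - q.1.2)) • z) (hE q.2 q.1.1).symm
  · obtain ⟨w, u⟩ := p
    simp only
    rw [norm_mul, Real.norm_eq_abs, Real.norm_of_nonneg (sq_nonneg _), mul_assoc]
    refine mul_le_mul_of_nonneg_left ?_ (abs_nonneg _)
    refine (aux_onorm_sq _).trans ?_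
    have a1 := h1 u w
    have a2 := h2 u w
    rw [inv_mul_eq_div, le_div_iff₀ (by positivity)]
    set G := ‖STOLCT P₁ P₂ P₃ φ f w u‖
    have hG : 0 ≤ G := norm_nonneg _
    calc 2 * G ^ 2 * (1 + ‖w‖ ^ 6) = 2 * (((1 + ‖w‖ ^ 6) * G) * G) := by ring
      _ ≤ 2 * (C1 * (C2 * ∫ x, |f x| * |φ (x - u)|)) := by
        refine mul_le_mul_of_nonneg_left ?_ (by norm_num)
        refine mul_le_mul a1 a2 hG ?_
        exact le_trans (by positivity) a1
      _ = _ := by ring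

lemma aux_fub (a : R3 → ℝ) (ha : Integrable a) (b : R3 → ℝ) (hb : Integrable b) :
    Integrable (fun u : R3 => ∫ x, a x * b (x - u)) ∧
      ∫ u : R3, ∫ x, a x * b (x - u) = (∫ x, a x) * ∫ x, b x := by
  have h := aux_conv a b ha hb
  refine ⟨h.integral_prod_left, ?_⟩
  rw [integral_integral_swap h]
  simp only [integral_const_mul]
  have : ∀ x : R3, ∫ u, b (x - u) = ∫ u, b u := fun x => integral_sub_left_eq_self b volume x
  simp only [this, integral_mul_const]

lemma aux_sq_int (f : 𝓢(R3, ℝ)) : Integrable (fun x : R3 => f x ^ 2) := by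
  obtain ⟨h, hh⟩ := aux_prodR f f 0
  refine (h.integrable (μ := volume)).congr (Filter.Eventually.of_forall fun x => ?_)
  simp [hh, sq]

/-- Logarithmic uncertainty principle for the STOLCT, assuming the logarithmic
uncertainty principle for the OLCT of real-valued Schwartz functions. -/
theorem stmt16 (P₁ P₂ P₃ : LCTParams)
    (h₁ : P₁.unimodular) (h₂ : P₂.unimodular) (h₃ : P₃.unimodular)
    (hb₁ : P₁.b ≠ 0) (hb₂ : P₂.b ≠ 0) (hb₃ : P₃.b ≠ 0)
    (D : ℝ) (hD : D = Real.log 2 + deriv Real.Gamma (1 / 2) / Real.Gamma (1 / 2))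
    (hOLCT : ∀ g : SchwartzMap R3 ℝ,
      D * ∫ x : R3, g x ^ 2 ≤
        2 * π * |P₃.b| * (∫ w : R3, Real.log ‖w‖ * onorm (OLCT P₁ P₂ P₃ (fun x => g x) w) ^ 2) +
          ∫ x : R3, Real.log ‖x‖ * g x ^ 2)
    (f φ : SchwartzMap R3 ℝ) (hφ0 : φ ≠ 0) :
    D * (∫ x : R3, f x ^ 2) * (∫ x : R3, φ x ^ 2) ≤
      2 * π * |P₃.b| *
          (∫ w : R3, ∫ u : R3,
            Real.log ‖w‖ * onorm (STOLCT P₁ P₂ P₃ (fun x => φ x) (fun x => f x) w u) ^ 2) +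
        (∫ x : R3, φ x ^ 2) * ∫ x : R3, Real.log ‖x‖ * f x ^ 2 := by
  have hJ := aux_J P₁ P₂ P₃ hb₁ hb₂ hb₃ f φ
  have hφi := aux_sq_int φ
  obtain ⟨iA, eA⟩ := aux_fub _ (aux_sq_int f) _ hφi
  obtain ⟨iB, eB⟩ := aux_fub _ (aux_log_schwartz f) _ hφi
  have key : ∀ u : R3, D * (∫ x : R3, f x ^ 2 * φ (x - u) ^ 2) ≤
      2 * π * |P₃.b| * (∫ w : R3, Real.log ‖w‖ *
        onorm (STOLCT P₁ P₂ P₃ (fun x => φ x) (fun x => f x) w u) ^ 2) +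
      ∫ x : R3, Real.log ‖x‖ * f x ^ 2 * φ (x - u) ^ 2 := by
    intro u
    obtain ⟨g, hg⟩ := aux_prodR f φ u
    have := hOLCT g
    simp only [hg, mul_pow, OLCT, ← mul_assoc] at this
    exact this
  have iJ : Integrable (fun u : R3 => ∫ w : R3, Real.log ‖w‖ *
        onorm (STOLCT P₁ P₂ P₃ (fun x => φ x) (fun x => f x) w u) ^ 2) :=
    hJ.integral_prod_right
  have fin := integral_mono (iA.const_mul D) ((iJ.const_mul (2 * π * |P₃.b|)).add iB) key
  simp only [Pi.add_apply] at fin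
  rw [integral_add (iJ.const_mul (2 * π * |P₃.b|)) iB, integral_const_mul, integral_const_mul,
    eA, eB] at fin
  rw [integral_integral_swap hJ]
  linarith
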